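/- arXiv:1310.2882 — 2 statements merged into one kernel-verified Lean document; each statement's English description precedes it below -/
import Mathlib

section
/- (Normalized Leaf Divergence Lemma for a DMS) Let L be a complete leaf set over a finite alphabet Z with branching set B, let P_Z be a probability distribution on Z with P_Z(z) > 0 for all z ∈ Z, and let P_Z^L be the induced leaf distribution. Let P_Y be any probability distribution on L with node probabilities Q and branching distributions P_{Y_t}, and let P_B(t) := Q(t)/E[ℓ(Y)]. Then D(P_Y ‖ P_Z^L) / E[ℓ(Y)] = Σ_{t ∈ B} P_B(t) D(P_{Y_t} ‖ P_Z), where terms with Q(t) = 0 are taken to be 0. -/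
open Finset

noncomputable section

/-- A finite set of nonempty strings over `Z` is a *complete leaf set* if it is
prefix-free and every sufficiently long string over `Z` has exactly one prefix in it
(equivalently, it is the leaf set of a finite rooted tree in which every branching
node has exactly `|Z|` children, one per letter). -/
def IsCompleteLeafSet {Z : Type*} (L : Finset (List Z)) : Prop :=
  (∀ t ∈ L, t ≠ []) ∧
  (∀ s ∈ L, ∀ t ∈ L, s <+: t → s = t) ∧
  (∃ N : ℕ, ∀ s : List Z, N ≤ s.length → ∃! t, t ∈ L ∧ t <+: s)

/-- The branching set: all proper prefixes of leaves, including the root `[]`. -/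
def branchSet {Z : Type*} [DecidableEq Z] (L : Finset (List Z)) : Finset (List Z) :=
  L.biUnion fun t => (Finset.range t.length).image fun i => t.take i

/-- Node probability `Q(t)`: total probability of the leaves having `t` as a prefix. -/
def nodeProb {Z : Type*} [DecidableEq Z] (L : Finset (List Z)) (P : List Z → ℝ)
    (t : List Z) : ℝ :=
  ∑ s ∈ L.filter (fun s => t <+: s), P s

/-- Branching distribution `P_{Y_t}(z) = Q(tz)/Q(t)` (junk value `0` when `Q(t) = 0`,
so that terms with `Q(t) = 0` vanish). -/
def branchDist {Z : Type*} [DecidableEq Z] (L : Finset (List Z)) (P : List Z → ℝ)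
    (t : List Z) (z : Z) : ℝ :=
  nodeProb L P (t ++ [z]) / nodeProb L P t

/-- Expected leaf depth `E[ℓ(Y)]`. -/
def expLen {Z : Type*} (L : Finset (List Z)) (P : List Z → ℝ) : ℝ :=
  ∑ t ∈ L, P t * t.length

/-- Shannon entropy in bits of `P` on the finite set `S` (terms with `P x = 0` vanish). -/
def ent {α : Type*} (S : Finset α) (P : α → ℝ) : ℝ :=
  ∑ x ∈ S, -(P x * Real.logb 2 (P x))

/-- Informational divergence in bits of `P` from `P'` on `S` (terms with `P x = 0` vanish). -/
def kl {α : Type*} (S : Finset α) (P P' : α → ℝ) : ℝ :=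
  ∑ x ∈ S, P x * Real.logb 2 (P x / P' x)

/-- The leaf distribution induced by a memoryless source: `P_Z^L(t) = ∏ i, P_Z(t_i)`. -/
def inducedProb {Z : Type*} (P : Z → ℝ) (t : List Z) : ℝ :=
  (t.map P).prod

/-- `L¹` (total variation) distance between two distributions on a finite alphabet. -/
def l1dist {Z : Type*} [Fintype Z] (P P' : Z → ℝ) : ℝ :=
  ∑ z, |P z - P' z|

theorem nodeProb_anti {Z : Type*} [DecidableEq Z] (L : Finset (List Z)) (P : List Z → ℝ)
    (hPnn : ∀ t ∈ L, 0 ≤ P t) (u v : List Z) (h : u <+: v) :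
    nodeProb L P v ≤ nodeProb L P u := by
  unfold nodeProb
  apply Finset.sum_le_sum_of_subset_of_nonneg
  · intro s hs
    rw [Finset.mem_filter] at hs ⊢
    exact ⟨hs.1, h.trans hs.2⟩
  · intro s hs _
    exact hPnn s (Finset.mem_filter.1 hs).1

theorem nodeProb_nonneg {Z : Type*} [DecidableEq Z] (L : Finset (List Z)) (P : List Z → ℝ)
    (hPnn : ∀ t ∈ L, 0 ≤ P t) (u : List Z) : 0 ≤ nodeProb L P u :=
  Finset.sum_nonneg fun s hs => hPnn s (Finset.mem_filter.1 hs).1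

theorem inducedProb_pos {Z : Type*} (PZ : Z → ℝ) (hZpos : ∀ z : Z, 0 < PZ z) (u : List Z) :
    0 < inducedProb PZ u := by
  induction u with
  | nil => simp [inducedProb]
  | cons a u ih =>
    have : inducedProb PZ (a :: u) = PZ a * inducedProb PZ u := by simp [inducedProb]
    rw [this]
    exact mul_pos (hZpos a) ih

theorem telescope {Z : Type*} [Fintype Z] [DecidableEq Z]
    (L : Finset (List Z))
    (PZ : Z → ℝ) (hZpos : ∀ z : Z, 0 < PZ z)
    (P : List Z → ℝ) (hPnn : ∀ t ∈ L, 0 ≤ P t) (hPsum : ∑ t ∈ L, P t = 1)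
    (B : Finset (List Z)) (u : List Z)
    (hB : ∀ v a, v ++ [a] <+: u → v ∈ B) (hu : 0 < nodeProb L P u) :
    ∑ t ∈ B, ∑ z : Z, (if t ++ [z] <+: u then
      Real.logb 2 (branchDist L P t z / PZ z) else 0) =
    Real.logb 2 (nodeProb L P u / inducedProb PZ u) := by
  induction u using List.reverseRecOn with
  | nil => simp [nodeProb, inducedProb, hPsum]
  | append_singleton v a ih =>
    have hv : 0 < nodeProb L P v :=
      lt_of_lt_of_le hu (nodeProb_anti L P hPnn _ _ (List.prefix_append v [a]))
    have ih' := ih (fun w b h => hB w b (h.trans (List.prefix_append v [a]))) hv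
    have hvB : v ∈ B := hB v a (List.prefix_refl _)
    have key : ∀ (t : List Z) (z : Z), (if t ++ [z] <+: v ++ [a] then
        Real.logb 2 (branchDist L P t z / PZ z) else 0) =
        (if t ++ [z] <+: v then Real.logb 2 (branchDist L P t z / PZ z) else 0) +
        (if t = v then (if z = a then Real.logb 2 (branchDist L P t z / PZ z) else 0) else 0) := by
      intro t z
      by_cases h1 : t ++ [z] <+: v
      · have h2 : t ≠ v := by
          rintro rfl
          have := h1.length_le
          simp at this
        simp [h1, h2, h1.trans (List.prefix_append v [a])]
      · by_cases h2 : t = v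
        · by_cases h3 : z = a
          · subst h2 h3
            simp [h1]
          · have : ¬ (t ++ [z] <+: v ++ [a]) := by
              rw [List.prefix_concat_iff]
              rintro (h | h)
              · simp [h2, h3] at h
              · exact h1 h
            simp [this, h1, h3]
        · have : ¬ (t ++ [z] <+: v ++ [a]) := by
            rw [List.prefix_concat_iff]
            rintro (h | h)
            · exact h2 (List.append_inj_left' h rfl)
            · exact h1 h
          simp [this, h1, h2]
    simp only [key, Finset.sum_add_distrib, ih']
    have h2 : ∑ t ∈ B, ∑ z : Z, (if t = v then
        (if z = a then Real.logb 2 (branchDist L P t z / PZ z) else 0) else 0) =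
        Real.logb 2 (branchDist L P v a / PZ a) := by
      rw [Finset.sum_eq_single v]
      · simp
      · intro b _ hb
        simp [hb]
      · exact fun h => absurd hvB h
    rw [h2]
    have hi := inducedProb_pos PZ hZpos v
    have ha := hZpos a
    have hc : inducedProb PZ (v ++ [a]) = inducedProb PZ v * PZ a := by simp [inducedProb]
    rw [hc, ← Real.logb_mul (by positivity) (by unfold branchDist; positivity)]
    congr 1
    unfold branchDist
    field_simp

/-- **Normalized Leaf Divergence Lemma for a DMS.**
`D(P_Y ‖ P_Z^L)/E[ℓ(Y)] = Σ_{t ∈ B} P_B(t) D(P_{Y_t} ‖ P_Z)`, where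
`P_B(t) = Q(t)/E[ℓ(Y)]` and terms with `Q(t) = 0` are taken to be `0`. -/
theorem normalized_leaf_divergence_lemma {Z : Type*} [Fintype Z] [DecidableEq Z]
    (L : Finset (List Z)) (hL : IsCompleteLeafSet L)
    (hZ : 2 ≤ Fintype.card Z)
    (PZ : Z → ℝ) (hZpos : ∀ z : Z, 0 < PZ z) (hZsum : ∑ z : Z, PZ z = 1)
    (P : List Z → ℝ) (hPnn : ∀ t ∈ L, 0 ≤ P t) (hPsum : ∑ t ∈ L, P t = 1) :
    kl L P (inducedProb PZ) / expLen L P =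
      ∑ t ∈ branchSet L, (nodeProb L P t / expLen L P) *
        kl Finset.univ (branchDist L P t) PZ := by
  have hterm : ∀ t ∈ branchSet L, (nodeProb L P t / expLen L P) *
        kl Finset.univ (branchDist L P t) PZ =
      (∑ s ∈ L, P s * ∑ z : Z, (if t ++ [z] <+: s then
        Real.logb 2 (branchDist L P t z / PZ z) else 0)) / expLen L P := by
    intro t _
    rw [div_mul_eq_mul_div]
    congr 1
    unfold kl
    simp only [Finset.mul_sum]
    rw [Finset.sum_comm]
    apply Finset.sum_congr rfl
    intro z _
    have h1 : nodeProb L P t * branchDist L P t z = nodeProb L P (t ++ [z]) := by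
      unfold branchDist
      by_cases h : nodeProb L P t = 0
      · have h2 := nodeProb_anti L P hPnn _ _ (List.prefix_append t [z])
        have h3 := nodeProb_nonneg L P hPnn (t ++ [z])
        rw [h] at h2 ⊢
        simp [le_antisymm h2 h3]
      · field_simp
    rw [← mul_assoc, h1]
    conv_lhs => rw [nodeProb, Finset.sum_mul, Finset.sum_filter]
    apply Finset.sum_congr rfl
    intro s _
    split_ifs <;> simp
  rw [Finset.sum_congr rfl hterm, ← Finset.sum_div]
  congr 1
  rw [Finset.sum_comm]
  unfold kl
  apply Finset.sum_congr rfl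
  intro s hs
  rw [← Finset.mul_sum]
  have hQ : nodeProb L P s = P s := by
    unfold nodeProb
    have : L.filter (fun x => s <+: x) = {s} := by
      ext x
      simp only [Finset.mem_filter, Finset.mem_singleton]
      constructor
      · rintro ⟨hx, h⟩
        exact (hL.2.1 s hs x hx h).symm
      · rintro rfl
        exact ⟨hs, List.prefix_refl _⟩
    rw [this, Finset.sum_singleton]
  rcases (hPnn s hs).eq_or_lt with h0 | h0
  · simp [← h0]
  · rw [telescope L PZ hZpos P hPnn hPsum (branchSet L) s ?_ (by rw [hQ]; exact h0), hQ]
    intro v a h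
    unfold branchSet
    simp only [Finset.mem_biUnion, Finset.mem_image, Finset.mem_range]
    refine ⟨s, hs, v.length, ?_, ?_⟩
    · have := h.length_le
      simp at this
      omega
    · exact (List.prefix_iff_eq_take.1 ((List.prefix_append v [a]).trans h)).symm
end
end

section
/- (Converse for deterministic encoders) Let X and Z be finite alphabets with m := |Z| ≥ 2, let P_X be a probability distribution on X with H(P_X) > 0, and let P_Z be a probability distribution on Z with P_Z(z) > 0 for all z ∈ Z. Let Dic be a complete leaf set over X (the dictionary), C a complete leaf set over Z (the codebook), and f : Dic → C any function. Let P_D := P_X^Dic and let P_Y be the pushforward of P_D under f. For 0 < ε ≤ 1/2 define θ(ε) := (ε² / log₂ m) · log₂(m/(e·ε)) and σ(ε) := ε · log₂(m²/(e·ε²)). If D(P_Y ‖ P_Z^C)/E[ℓ(Y)] ≤ θ(ε)²/(2 ln 2), then E[ℓ(D)]/E[ℓ(Y)] ≥ H(P_Z)/H(P_X) − σ(ε)/H(P_X), where E[ℓ(D)] := Σ_{d ∈ Dic} P_D(d) ℓ(d) and E[ℓ(Y)] := Σ_{c ∈ C} P_Y(c) ℓ(c). -/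
open Finset

noncomputable section

/-- The pushforward of a distribution on the dictionary under an encoding map. -/
def pushf {X Z : Type*} [DecidableEq Z] (Dic : Finset (List X)) (f : List X → List Z)
    (P : List X → ℝ) (c : List Z) : ℝ :=
  ∑ d ∈ Dic.filter (fun d => f d = c), P d

lemma hel_aux (p q : ℝ) (hp : 0 ≤ p) (hq : 0 < q) :
    (√p - √q) ^ 2 ≤ p * Real.log p - p * Real.log q - p + q := by
  rcases hp.eq_or_lt with rfl | hp
  · simp [Real.sq_sqrt hq.le]
  have h1 : 0 < √p := Real.sqrt_pos.2 hp
  have h2 : 0 < √q := Real.sqrt_pos.2 hq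
  have h := Real.log_le_sub_one_of_pos (div_pos h2 h1)
  rw [Real.log_div h2.ne' h1.ne', Real.log_sqrt hp.le, Real.log_sqrt hq.le] at h
  have e1 : √p ^ 2 = p := Real.sq_sqrt hp.le
  have e2 : √q ^ 2 = q := Real.sq_sqrt hq.le
  have h3 := mul_le_mul_of_nonneg_left h (by positivity : 0 ≤ 2 * p)
  have h4 : 2 * p * (√q / √p - 1) = 2 * (√p * √q) - 2 * p := by
    have : p * (√q / √p) = √p * √q := by
      nth_rewrite 1 [← e1]; field_simp
    linear_combination 2 * this
  nlinarith

lemma l1_aux (p q θ : ℝ) (hp : 0 ≤ p) (hq : 0 < q) (hθ : 0 < θ) :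
    |p - q| ≤ θ * (p + q) / 2 + (p * Real.log p - p * Real.log q - p + q) / θ := by
  have h := hel_aux p q hp hq
  have e1 : √p ^ 2 = p := Real.sq_sqrt hp
  have e2 : √q ^ 2 = q := Real.sq_sqrt hq.le
  have h' : (√p - √q) ^ 2 / θ ≤ (p * Real.log p - p * Real.log q - p + q) / θ := by gcongr
  refine le_trans ?_ (add_le_add_right h' _)
  have e3 : p - q = (√p - √q) * (√p + √q) := by linear_combination -e1 + e2
  have key : ∀ x y : ℝ, |x * y| ≤ θ * y ^ 2 / 4 + x ^ 2 / θ := by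
    intro x y
    have h1 : θ * y ^ 2 / 4 + x ^ 2 / θ - x * y = (θ * y / 2 - x) ^ 2 / θ := by field_simp; ring
    have h2 : θ * y ^ 2 / 4 + x ^ 2 / θ + x * y = (θ * y / 2 + x) ^ 2 / θ := by field_simp; ring
    have h3 : 0 ≤ (θ * y / 2 - x) ^ 2 / θ := by positivity
    have h4 : 0 ≤ (θ * y / 2 + x) ^ 2 / θ := by positivity
    rw [abs_le]; constructor <;> linarith
  have := key (√p - √q) (√p + √q)
  rw [← e3] at this
  nlinarith [mul_nonneg hθ.le (sq_nonneg (√p - √q))]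

lemma ent_aux (p q τ : ℝ) (hp : 0 ≤ p) (hp1 : p ≤ 1) (hq : 0 < q) (hτ : 0 < τ)
    (ha : 1 ≤ -Real.log τ - 1) :
    p * Real.log p - q * Real.log q ≤ (-Real.log τ - 1) * |p - q| + τ := by
  rcases le_total q p with h | h
  · have hp0 : 0 < p := hq.trans_le h
    have h1 : |p - q| = p - q := abs_of_nonneg (by linarith)
    have h2 := Real.log_le_sub_one_of_pos (div_pos hp0 hq)
    rw [Real.log_div hp0.ne' hq.ne'] at h2
    have h3 := mul_le_mul_of_nonneg_left h2 hq.le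
    have h4 : q * (p / q - 1) = p - q := by field_simp
    have h5 := Real.log_nonpos hp hp1
    rw [h1]
    nlinarith
  · have h1 : |p - q| = q - p := by rw [abs_of_nonpos (by linarith)]; ring
    rw [h1]
    rcases h.eq_or_lt with rfl | h
    · simp; exact hτ.le
    have hs : 0 < q - p := by linarith
    have h5 : p * Real.log p ≤ p * Real.log q := by
      rcases hp.eq_or_lt with rfl | hp
      · simp
      · gcongr
    have h6 : Real.log (q - p) ≤ Real.log q := Real.log_le_log hs (by linarith)
    have h2 := Real.log_le_sub_one_of_pos (div_pos hτ hs)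
    rw [Real.log_div hτ.ne' hs.ne'] at h2
    have h3 := mul_le_mul_of_nonneg_left h2 hs.le
    have h4 : (q - p) * (τ / (q - p) - 1) = τ - (q - p) := by field_simp
    nlinarith

lemma node_aux {Z : Type*} [Fintype Z] (PZ : Z → ℝ) (hZpos : ∀ z : Z, 0 < PZ z)
    (hZsum : ∑ z : Z, PZ z = 1) (Q : ℝ) (hQ : 0 ≤ Q) (x : Z → ℝ) (hx : ∀ z, 0 ≤ x z)
    (hs : ∑ z, x z = Q) (θ τ : ℝ) (hθ : 0 < θ) (hτ : 0 < τ) (ha : 1 ≤ -Real.log τ - 1) :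
    Q * (∑ z, -(PZ z * Real.log (PZ z))) + ∑ z, x z * (Real.log (x z) - Real.log Q) ≤
      Q * ((-Real.log τ - 1) * θ + Fintype.card Z * τ) + (-Real.log τ - 1) / θ *
        (∑ z, x z * (Real.log (x z) - Real.log Q) - ∑ z, x z * Real.log (PZ z)) := by
  rcases hQ.eq_or_lt with rfl | hQ
  · have : ∀ z, x z = 0 := fun z =>
      (Finset.sum_eq_zero_iff_of_nonneg (fun i _ => hx i)).1 hs z (Finset.mem_univ z)
    simp [this]
  set a := -Real.log τ - 1 with hadef
  have key : ∀ z, Q * (-(PZ z * Real.log (PZ z))) + x z * (Real.log (x z) - Real.log Q) ≤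
      a * θ / 2 * (x z + Q * PZ z) + a / θ * (x z * (Real.log (x z) - Real.log Q)
        - x z * Real.log (PZ z) - x z + Q * PZ z) + Q * τ := by
    intro z
    have hp0 : 0 ≤ x z / Q := div_nonneg (hx z) hQ.le
    have hp1 : x z / Q ≤ 1 := by
      rw [div_le_one hQ, ← hs]
      exact Finset.single_le_sum (fun i _ => hx i) (Finset.mem_univ z)
    have h1 := ent_aux (x z / Q) (PZ z) τ hp0 hp1 (hZpos z) hτ ha
    have h2 := l1_aux (x z / Q) (PZ z) θ hp0 (hZpos z) hθ
    have h3 := mul_le_mul_of_nonneg_left h2 (by linarith : 0 ≤ a)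
    have h4 := mul_le_mul_of_nonneg_left (h1.trans (add_le_add_left h3 τ)) hQ.le
    have e0 : Q * (x z / Q) = x z := by field_simp
    have e1 : x z / Q * Real.log (x z / Q) = x z / Q * (Real.log (x z) - Real.log Q) := by
      rcases (hx z).eq_or_lt with h | h
      · simp [← h]
      · rw [Real.log_div h.ne' hQ.ne']
    rw [e1] at h4
    have e2 : Q * (x z / Q * (Real.log (x z) - Real.log Q) - PZ z * Real.log (PZ z)) =
      Q * (-(PZ z * Real.log (PZ z))) + x z * (Real.log (x z) - Real.log Q) := by
      linear_combination (Real.log (x z) - Real.log Q) * e0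
    rw [e2] at h4
    refine h4.trans (le_of_eq ?_)
    linear_combination (a * θ / 2 + a / θ * (Real.log (x z) - Real.log Q - Real.log (PZ z) - 1)) * e0
  have hsum := Finset.sum_le_sum (fun z (_ : z ∈ Finset.univ) => key z)
  simp only [Finset.sum_add_distrib, ← Finset.mul_sum, Finset.sum_sub_distrib, hs, hZsum,
    Finset.sum_const, Finset.card_univ, nsmul_eq_mul] at hsum
  simp only [mul_sub, Finset.sum_sub_distrib] at hsum ⊢
  linarith

lemma final_aux (m ε θ : ℝ) (hm : 2 ≤ m) (hε0 : 0 < ε) (hε : ε ≤ 1 / 2)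
    (hθ : θ = ε ^ 2 / Real.log m * Real.log (m / (Real.exp 1 * ε))) :
    0 < θ ∧ 1 ≤ -Real.log (ε ^ 2 / m) - 1 ∧
    3 / 2 * θ * (-Real.log (ε ^ 2 / m) - 1) + ε ^ 2 ≤
      ε * Real.log (m ^ 2 / (Real.exp 1 * ε ^ 2)) := by
  have hm0 : 0 < m := by linarith
  have hL : Real.log 2 ≤ Real.log m := Real.log_le_log (by norm_num) hm
  have hl2 := Real.log_two_gt_d9
  have e1 : Real.log (m / (Real.exp 1 * ε)) = Real.log m - 1 - Real.log ε := by
    rw [Real.log_div hm0.ne' (by positivity), Real.log_mul (Real.exp_pos 1).ne' hε0.ne',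
      Real.log_exp]; ring
  have e2 : Real.log (ε ^ 2 / m) = 2 * Real.log ε - Real.log m := by
    rw [Real.log_div (by positivity) hm0.ne', Real.log_pow]; norm_num
  have e3 : Real.log (m ^ 2 / (Real.exp 1 * ε ^ 2)) = 2 * Real.log m - 1 - 2 * Real.log ε := by
    rw [Real.log_div (by positivity) (by positivity), Real.log_mul (by positivity) (by positivity),
      Real.log_exp, Real.log_pow, Real.log_pow]; norm_num; ring
  have hle : Real.log ε ≤ -Real.log 2 := by
    rw [← Real.log_inv]; exact Real.log_le_log hε0 (by linarith)
  rw [e2, e3]; rw [e1] at hθ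
  set L := Real.log m
  set l := Real.log ε
  have hL0 : 0 < L := by linarith
  have h1 : ε * (-1 - l) ≤ 0.37 - ε := by
    have h := Real.log_le_sub_one_of_pos (show 0 < 1 / (Real.exp 1 * ε) by positivity)
    rw [Real.log_div one_ne_zero (by positivity), Real.log_mul (Real.exp_pos 1).ne' hε0.ne',
      Real.log_exp, Real.log_one] at h
    have h' := mul_le_mul_of_nonneg_left h hε0.le
    have h2 : ε * (1 / (Real.exp 1 * ε) - 1) = 1 / Real.exp 1 - ε := by field_simp
    have h3 : 1 / Real.exp 1 ≤ 0.37 := by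
      rw [div_le_iff₀ (Real.exp_pos 1)]; nlinarith [Real.exp_one_gt_d9]
    have h4 : ε * (0 - (1 + l)) = ε * (-1 - l) := by ring
    linarith
  have hθ1 : 3 / 2 * θ ≤ ε := by
    have : θ * L = ε * (ε * (L - 1 - l)) := by rw [hθ]; field_simp
    have h2 : 3 / 2 * (ε * (L - 1 - l)) ≤ L := by nlinarith
    have h3 : 3 / 2 * θ * L ≤ ε * L := by nlinarith
    exact le_of_mul_le_mul_right h3 hL0
  have hθ0 : 0 < θ := by
    rw [hθ]
    have : 0 < L - 1 - l := by linarith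
    positivity
  refine ⟨hθ0, by linarith, ?_⟩
  have ha : 0 ≤ -(2 * l - L) - 1 := by linarith
  have := mul_le_mul_of_nonneg_right hθ1 ha
  nlinarith

section tree
set_option linter.unusedSectionVars false
variable {Z : Type*} [Fintype Z] [DecidableEq Z]

lemma prefix_split (t s : List Z) (h : s ≠ t) (c : ℝ) :
    (if t <+: s then c else 0) = ∑ z, if t ++ [z] <+: s then c else 0 := by
  by_cases hp : t <+: s
  · obtain ⟨r, rfl⟩ := hp
    cases r with
    | nil => simp at h
    | cons a r =>
      have : ∀ z, (t ++ [z] <+: t ++ a :: r) ↔ a = z := by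
        intro z
        rw [List.prefix_append_right_inj]
        simp [List.cons_prefix_cons, eq_comm]
      simp [this]
  · have : ∀ z, ¬ (t ++ [z] <+: s) := fun z hz => hp ((List.prefix_append t [z]).trans hz)
    simp [hp, this]

lemma nodeProb_split (L : Finset (List Z)) (P : List Z → ℝ) (t : List Z) (ht : t ∉ L) :
    nodeProb L P t = ∑ z, nodeProb L P (t ++ [z]) := by
  simp only [nodeProb, Finset.sum_filter]
  rw [Finset.sum_comm]
  refine Finset.sum_congr rfl fun s hs => prefix_split t s (fun h => ht (h ▸ hs)) _

lemma nodeProb_leaf (L : Finset (List Z)) (P : List Z → ℝ)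
    (hpf : ∀ s ∈ L, ∀ t ∈ L, s <+: t → s = t) (t : List Z) (ht : t ∈ L) :
    nodeProb L P t = P t := by
  have : L.filter (fun s => t <+: s) = {t} := by
    ext s
    simp only [Finset.mem_filter, Finset.mem_singleton]
    constructor
    · rintro ⟨h1, h2⟩; exact (hpf t ht s h1 h2).symm
    · rintro rfl; exact ⟨ht, List.prefix_rfl⟩
  simp [nodeProb, this]

lemma branch_no_prefix (L : Finset (List Z))
    (hpf : ∀ s ∈ L, ∀ t ∈ L, s <+: t → s = t) (t : List Z) (ht : t ∈ branchSet L)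
    (s : List Z) (hs : s ∈ L) : ¬ s <+: t := by
  intro h
  simp only [branchSet, Finset.mem_biUnion, Finset.mem_image, Finset.mem_range] at ht
  obtain ⟨u, hu, i, hi, rfl⟩ := ht
  have h1 := hpf s hs u hu (h.trans (List.take_prefix i u))
  subst h1
  have := h.length_le
  simp at this
  omega

lemma take_mem_branch (L : Finset (List Z)) (s : List Z) (hs : s ∈ L) (i : ℕ)
    (hi : i < s.length) : s.take i ∈ branchSet L := by
  simp only [branchSet, Finset.mem_biUnion, Finset.mem_image, Finset.mem_range]
  exact ⟨s, hs, i, hi, rfl⟩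

lemma path_sum (B : Finset (List Z)) (g : List Z → Z → ℝ) (h : List Z → ℝ)
    (h0 : h [] = 0) (hstep : ∀ u a, h (u ++ [a]) = h u + g u a) (s : List Z) :
    (∀ i < s.length, s.take i ∈ B) →
    (∑ t ∈ B, ∑ z, if t ++ [z] <+: s then g t z else 0) = h s := by
  induction s using List.reverseRecOn with
  | nil => intro _; simp [h0]
  | append_singleton u a ih =>
    intro hB
    have hu : u ∈ B := by
      have := hB u.length (by simp)
      simpa using this
    have ih' := ih (fun i hi => by
      have := hB i (by simp; omega)
      rwa [List.take_append_of_le_length hi.le] at this)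
    rw [hstep, ← ih']
    have key : ∀ t z, (if t ++ [z] <+: u ++ [a] then g t z else 0) =
        (if t ++ [z] <+: u then g t z else 0) + if u = t then (if a = z then g t z else 0) else 0 := by
      intro t z
      simp only [List.prefix_concat_iff]
      by_cases h1 : t ++ [z] <+: u
      · have : u ≠ t := by
          rintro rfl
          have := h1.length_le
          simp at this
        simp [h1, this]
      · by_cases h2 : u = t
        · subst h2
          by_cases h3 : a = z
          · subst h3; simp [h1]
          · simp [h1, h3, Ne.symm h3]
        · simp [h1, h2, Ne.symm h2]
    simp only [key, Finset.sum_add_distrib]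
    congr 1
    have : ∀ t, (∑ z, if u = t then (if a = z then g t z else 0) else 0) =
        if u = t then g t a else 0 := by
      intro t; split_ifs <;> simp
    simp [this, hu]

lemma leaf_sum (L : Finset (List Z)) (P : List Z → ℝ) (g : List Z → Z → ℝ) (h : List Z → ℝ)
    (h0 : h [] = 0) (hstep : ∀ u a, h (u ++ [a]) = h u + g u a) :
    ∑ s ∈ L, P s * h s = ∑ t ∈ branchSet L, ∑ z, nodeProb L P (t ++ [z]) * g t z := by
  have : ∀ s ∈ L, P s * h s =
      ∑ t ∈ branchSet L, ∑ z, if t ++ [z] <+: s then P s * g t z else 0 := by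
    intro s hs
    rw [← path_sum (branchSet L) g h h0 hstep s (fun i hi => take_mem_branch L s hs i hi),
      Finset.mul_sum]
    refine Finset.sum_congr rfl fun t _ => ?_
    rw [Finset.mul_sum]
    refine Finset.sum_congr rfl fun z _ => ?_
    split_ifs <;> simp
  rw [Finset.sum_congr rfl this, Finset.sum_comm]
  refine Finset.sum_congr rfl fun t _ => ?_
  rw [Finset.sum_comm]
  refine Finset.sum_congr rfl fun z _ => ?_
  rw [nodeProb, Finset.sum_mul, Finset.sum_filter]

lemma expLen_eq (L : Finset (List Z)) (P : List Z → ℝ)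
    (hpf : ∀ s ∈ L, ∀ t ∈ L, s <+: t → s = t) :
    expLen L P = ∑ t ∈ branchSet L, nodeProb L P t := by
  rw [expLen, leaf_sum L P (fun _ _ => 1) (fun s => (s.length : ℝ)) (by simp) (by simp)]
  refine Finset.sum_congr rfl fun t ht => ?_
  rw [nodeProb_split L P t (fun h => branch_no_prefix L hpf t ht t h List.prefix_rfl)]
  simp

lemma inducedProb_concat (P : Z → ℝ) (t : List Z) (z : Z) :
    inducedProb P (t ++ [z]) = inducedProb P t * P z := by
  simp [inducedProb]

lemma inducedProb_nonneg (P : Z → ℝ) (hP : ∀ z, 0 ≤ P z) (t : List Z) : 0 ≤ inducedProb P t := by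
  refine List.prod_nonneg ?_
  simp only [List.mem_map]
  rintro _ ⟨z, _, rfl⟩
  exact hP z

lemma log_inducedProb (P : Z → ℝ) (t : List Z) (h : inducedProb P t ≠ 0) :
    Real.log (inducedProb P t) = (t.map fun z => Real.log (P z)).sum := by
  induction t using List.reverseRecOn with
  | nil => simp [inducedProb]
  | append_singleton u a ih =>
    rw [inducedProb_concat] at h ⊢
    rw [Real.log_mul (left_ne_zero_of_mul h) (right_ne_zero_of_mul h), ih (left_ne_zero_of_mul h)]
    simp

lemma nodeProb_induced (L : Finset (List Z)) (hL : IsCompleteLeafSet L) (P : Z → ℝ)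
    (hsum : ∑ z, P z = 1) (t : List Z) (ht : ∀ s ∈ L, s <+: t → s = t) :
    nodeProb L (inducedProb P) t = inducedProb P t := by
  obtain ⟨_, hpf, N, hN⟩ := hL
  suffices H : ∀ k : ℕ, ∀ t : List Z, N ≤ t.length + k → (∀ s ∈ L, s <+: t → s = t) →
      nodeProb L (inducedProb P) t = inducedProb P t from H N t (by omega) ht
  intro k
  induction k with
  | zero =>
    intro t h1 h2
    obtain ⟨s, ⟨hs, hst⟩, _⟩ := hN t (by simpa using h1)
    obtain rfl := h2 s hs hst
    exact nodeProb_leaf L _ hpf s hs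
  | succ k ih =>
    intro t h1 h2
    by_cases h : t ∈ L
    · exact nodeProb_leaf L _ hpf t h
    rw [nodeProb_split L _ t h]
    have : ∀ z, nodeProb L (inducedProb P) (t ++ [z]) = inducedProb P t * P z := by
      intro z
      rw [ih (t ++ [z]) (by simp; omega) ?_, inducedProb_concat]
      intro s hs hst
      rcases List.prefix_concat_iff.1 hst with h3 | h3
      · exact h3
      · exact absurd (h2 s hs h3 ▸ hs) h
    simp only [this, ← Finset.mul_sum, hsum, mul_one]

lemma sum_induced (L : Finset (List Z)) (hL : IsCompleteLeafSet L) (P : Z → ℝ)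
    (hsum : ∑ z, P z = 1) : ∑ s ∈ L, inducedProb P s = 1 := by
  have h := nodeProb_induced L hL P hsum [] (fun s _ h => List.prefix_nil.1 h)
  simpa [nodeProb, inducedProb] using h

lemma ent_induced (L : Finset (List Z)) (hL : IsCompleteLeafSet L) (P : Z → ℝ)
    (hsum : ∑ z, P z = 1) :
    ∑ s ∈ L, inducedProb P s * Real.log (inducedProb P s) =
      expLen L (inducedProb P) * ∑ z, P z * Real.log (P z) := by
  have h1 : ∀ s ∈ L, inducedProb P s * Real.log (inducedProb P s) =
      inducedProb P s * (s.map fun z => Real.log (P z)).sum := by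
    intro s _
    by_cases h : inducedProb P s = 0
    · simp [h]
    · rw [log_inducedProb P s h]
  rw [Finset.sum_congr rfl h1, leaf_sum L (inducedProb P) (fun _ z => Real.log (P z))
    (fun s => (s.map fun z => Real.log (P z)).sum) (by simp) (by simp),
    expLen_eq L _ hL.2.1, Finset.sum_mul]
  refine Finset.sum_congr rfl fun t ht => ?_
  have hb := branch_no_prefix L hL.2.1 t ht
  rw [Finset.mul_sum]
  refine Finset.sum_congr rfl fun z _ => ?_
  rw [nodeProb_induced L hL P hsum t (fun s hs h => absurd h (hb s hs)),
    nodeProb_induced L hL P hsum (t ++ [z]) ?_, inducedProb_concat]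
  · ring
  · intro s hs h
    rcases List.prefix_concat_iff.1 h with h3 | h3
    · exact h3
    · exact absurd h3 (hb s hs)

lemma code_bound (PZ : Z → ℝ) (hZpos : ∀ z : Z, 0 < PZ z) (hZsum : ∑ z : Z, PZ z = 1)
    (C : Finset (List Z)) (hpf : ∀ s ∈ C, ∀ t ∈ C, s <+: t → s = t) (P : List Z → ℝ)
    (hP : ∀ s, 0 ≤ P s) (hPs : ∑ s ∈ C, P s = 1)
    (θ τ : ℝ) (hθ : 0 < θ) (hτ : 0 < τ) (ha : 1 ≤ -Real.log τ - 1) :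
    expLen C P * (∑ z, -(PZ z * Real.log (PZ z))) + ∑ s ∈ C, P s * Real.log (P s) ≤
      expLen C P * ((-Real.log τ - 1) * θ + Fintype.card Z * τ) + (-Real.log τ - 1) / θ *
        (∑ s ∈ C, P s * Real.log (P s / inducedProb PZ s)) := by
  have hroot : nodeProb C P [] = 1 := by simpa [nodeProb] using hPs
  have hnn : ∀ t, 0 ≤ nodeProb C P t := fun t => Finset.sum_nonneg fun s _ => hP s
  have e1 : ∑ s ∈ C, P s * Real.log (P s) = ∑ t ∈ branchSet C, ∑ z, nodeProb C P (t ++ [z]) *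
      (Real.log (nodeProb C P (t ++ [z])) - Real.log (nodeProb C P t)) := by
    rw [← leaf_sum C P (fun t z => Real.log (nodeProb C P (t ++ [z])) - Real.log (nodeProb C P t))
      (fun s => Real.log (nodeProb C P s)) (by simp [hroot]) (fun u a => by ring)]
    refine Finset.sum_congr rfl fun s hs => ?_
    rw [nodeProb_leaf C P hpf s hs]
  have hpos : ∀ s, inducedProb PZ s ≠ 0 := by
    intro s
    refine (List.prod_pos ?_).ne'
    simp only [List.mem_map]
    rintro _ ⟨z, _, rfl⟩
    exact hZpos z
  have e2 : ∑ s ∈ C, P s * Real.log (inducedProb PZ s) =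
      ∑ t ∈ branchSet C, ∑ z, nodeProb C P (t ++ [z]) * Real.log (PZ z) := by
    rw [← leaf_sum C P (fun _ z => Real.log (PZ z))
      (fun s => (s.map fun z => Real.log (PZ z)).sum) (by simp) (by simp)]
    refine Finset.sum_congr rfl fun s _ => ?_
    rw [log_inducedProb PZ s (hpos s)]
  have e3 : ∑ s ∈ C, P s * Real.log (P s / inducedProb PZ s) =
      ∑ s ∈ C, P s * Real.log (P s) - ∑ s ∈ C, P s * Real.log (inducedProb PZ s) := by
    rw [← Finset.sum_sub_distrib]
    refine Finset.sum_congr rfl fun s _ => ?_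
    by_cases h : P s = 0
    · simp [h]
    · rw [Real.log_div h (hpos s)]; ring
  rw [e3, e1, e2, expLen_eq C P hpf, Finset.sum_mul, Finset.sum_mul, ← Finset.sum_add_distrib,
    ← Finset.sum_sub_distrib, Finset.mul_sum, ← Finset.sum_add_distrib]
  refine Finset.sum_le_sum fun t ht => ?_
  exact node_aux PZ hZpos hZsum _ (hnn t) (fun z => nodeProb C P (t ++ [z])) (fun z => hnn _)
    (nodeProb_split C P t (fun h => branch_no_prefix C hpf t ht t h List.prefix_rfl)).symm
    θ τ hθ hτ ha

end tree

lemma push_sum {X Z : Type*} [DecidableEq Z] (Dic : Finset (List X)) (C : Finset (List Z))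
    (f : List X → List Z) (hf : ∀ d ∈ Dic, f d ∈ C) (P : List X → ℝ) (g : List Z → ℝ) :
    ∑ c ∈ C, pushf Dic f P c * g c = ∑ d ∈ Dic, P d * g (f d) := by
  rw [← Finset.sum_fiberwise_of_maps_to hf]
  refine Finset.sum_congr rfl fun c _ => ?_
  rw [pushf, Finset.sum_mul]
  refine Finset.sum_congr rfl fun d hd => ?_
  rw [(Finset.mem_filter.1 hd).2]

lemma push_ent {X Z : Type*} [DecidableEq Z] (Dic : Finset (List X)) (C : Finset (List Z))
    (f : List X → List Z) (hf : ∀ d ∈ Dic, f d ∈ C) (P : List X → ℝ) (hP : ∀ d, 0 ≤ P d) :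
    ∑ d ∈ Dic, P d * Real.log (P d) ≤
      ∑ c ∈ C, pushf Dic f P c * Real.log (pushf Dic f P c) := by
  rw [push_sum Dic C f hf P (fun c => Real.log (pushf Dic f P c))]
  refine Finset.sum_le_sum fun d hd => ?_
  rcases (hP d).eq_or_lt with h | h
  · simp [← h]
  · refine mul_le_mul_of_nonneg_left (Real.log_le_log h ?_) h.le
    exact Finset.single_le_sum (f := P) (fun i _ => hP i) (Finset.mem_filter.2 ⟨hd, rfl⟩)

/-- **Converse for deterministic encoders.** With `m = |Z| ≥ 2`,
`θ(ε) = (ε²/log₂ m) log₂(m/(eε))` and `σ(ε) = ε log₂(m²/(eε²))` for `0 < ε ≤ 1/2`: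
if `D(P_Y ‖ P_Z^C)/E[ℓ(Y)] ≤ θ(ε)²/(2 ln 2)` then
`E[ℓ(D)]/E[ℓ(Y)] ≥ H(P_Z)/H(P_X) − σ(ε)/H(P_X)`. -/
theorem deterministic_encoder_converse {X Z : Type*}
    [Fintype X] [DecidableEq X] [Fintype Z] [DecidableEq Z]
    (hZ : 2 ≤ Fintype.card Z)
    (PX : X → ℝ) (hXnn : ∀ x : X, 0 ≤ PX x) (hXsum : ∑ x : X, PX x = 1)
    (hHX : 0 < ent Finset.univ PX)
    (PZ : Z → ℝ) (hZpos : ∀ z : Z, 0 < PZ z) (hZsum : ∑ z : Z, PZ z = 1)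
    (Dic : Finset (List X)) (hDic : IsCompleteLeafSet Dic)
    (C : Finset (List Z)) (hC : IsCompleteLeafSet C)
    (f : List X → List Z) (hf : ∀ d ∈ Dic, f d ∈ C)
    (ε : ℝ) (hε0 : 0 < ε) (hε : ε ≤ 1 / 2)
    (hdiv : kl C (pushf Dic f (inducedProb PX)) (inducedProb PZ) /
        expLen C (pushf Dic f (inducedProb PX)) ≤
      (ε ^ 2 / Real.logb 2 (Fintype.card Z) *
        Real.logb 2 (Fintype.card Z / (Real.exp 1 * ε))) ^ 2 / (2 * Real.log 2)) :
    ent Finset.univ PZ / ent Finset.univ PX -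
        ε * Real.logb 2 ((Fintype.card Z : ℝ) ^ 2 / (Real.exp 1 * ε ^ 2)) /
          ent Finset.univ PX ≤
      expLen Dic (inducedProb PX) / expLen C (pushf Dic f (inducedProb PX)) := by
  have hl2 : 0 < Real.log 2 := Real.log_pos (by norm_num)
  set m : ℝ := (Fintype.card Z : ℝ) with hmdef
  have hm : 2 ≤ m := by rw [hmdef]; exact_mod_cast hZ
  set PD := inducedProb PX with hPD
  set PY := pushf Dic f PD with hPY
  have hPDnn : ∀ d, 0 ≤ PD d := inducedProb_nonneg PX hXnn
  have hPYnn : ∀ c, 0 ≤ PY c := fun c => Finset.sum_nonneg fun d _ => hPDnn d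
  have hPYs : ∑ c ∈ C, PY c = 1 := by
    have := push_sum Dic C f hf PD (fun _ => 1)
    simp only [mul_one] at this
    rw [hPY, this]
    exact sum_induced Dic hDic PX hXsum
  have hE : 0 < expLen C PY := by
    have : ∑ c ∈ C, PY c ≤ expLen C PY := by
      refine Finset.sum_le_sum fun c hc => ?_
      have h1 : 1 ≤ c.length := List.length_pos_iff.2 (hC.1 c hc)
      have h2 : (1 : ℝ) ≤ c.length := by exact_mod_cast h1
      exact le_mul_of_one_le_right (hPYnn c) h2
    linarith
  obtain ⟨hθ, ha, hfin⟩ := final_aux m ε _ hm hε0 hε rfl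
  have hθe : ε ^ 2 / Real.logb 2 m * Real.logb 2 (m / (Real.exp 1 * ε)) =
      ε ^ 2 / Real.log m * Real.log (m / (Real.exp 1 * ε)) := by
    have : 0 < Real.log m := Real.log_pos (by linarith)
    simp only [Real.logb]; field_simp
  rw [hθe] at hdiv
  set θ := ε ^ 2 / Real.log m * Real.log (m / (Real.exp 1 * ε))
  set a := -Real.log (ε ^ 2 / m) - 1
  have hm0 : 0 < m := by linarith
  have hcode := code_bound PZ hZpos hZsum C hC.2.1 PY hPYnn hPYs θ (ε ^ 2 / m) hθ
    (by positivity) ha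
  have hkl : kl C PY (inducedProb PZ) =
      (∑ s ∈ C, PY s * Real.log (PY s / inducedProb PZ s)) / Real.log 2 := by
    simp only [kl, Real.logb, Finset.sum_div, mul_div_assoc]
  set K := ∑ s ∈ C, PY s * Real.log (PY s / inducedProb PZ s)
  have hK : K ≤ θ ^ 2 / 2 * expLen C PY := by
    rw [hkl, div_le_iff₀ hE, div_le_iff₀ hl2] at hdiv
    refine hdiv.trans (le_of_eq ?_)
    field_simp
  have hX2 : ent Finset.univ PX = (∑ x, -(PX x * Real.log (PX x))) / Real.log 2 := by
    simp only [ent, Real.logb, Finset.sum_div, mul_div_assoc, neg_div]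
  have hZ2 : ent Finset.univ PZ = (∑ x, -(PZ x * Real.log (PZ x))) / Real.log 2 := by
    simp only [ent, Real.logb, Finset.sum_div, mul_div_assoc, neg_div]
  have hpe := push_ent Dic C f hf PD hPDnn
  rw [ent_induced Dic hDic PX hXsum] at hpe
  rw [← sub_div, div_le_div_iff₀ hHX hE, hX2, hZ2, Real.logb, ← mul_div_assoc, ← sub_div,
    ← mul_div_assoc, div_mul_eq_mul_div]
  refine div_le_div_of_nonneg_right ?_ hl2.le
  have e : m * (ε ^ 2 / m) = ε ^ 2 := by field_simp
  rw [← hmdef, e] at hcode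
  have h1 : a / θ * K ≤ expLen C PY * (a * θ / 2) := by
    have := mul_le_mul_of_nonneg_left hK (show 0 ≤ a / θ by positivity)
    refine this.trans (le_of_eq ?_)
    field_simp
  have h2 := mul_le_mul_of_nonneg_left hfin hE.le
  have h3 : ∑ x, -(PX x * Real.log (PX x)) = - ∑ x, (PX x * Real.log (PX x)) := by simp
  rw [h3]
  nlinarith
end
end
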